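/- arXiv:2402.15568 — 4 statements merged into one kernel-verified Lean document; each statement's English description precedes it below -/
import Mathlib

section
/- Narayana count of chord diagrams: for integers n ≥ 4 and k ≥ 0, the number of chord diagrams in CD_{n,k} equals the Narayana number N(n−3, k+1), i.e. |CD_{n,k}| = (1/(k+1))·C(n−4, k)·C(n−3, k), where C(·,·) denotes a binomial coefficient. -/
/-- A chord diagram in `CD_{n,k}`: a set of `k` quadruples (chords)
`(a, b, c, d)` of integers with `b = a + 1`, `d = c + 1`,
`1 ≤ a < b < c < d ≤ n - 1`, such that no two distinct chords share the same
start `a`, and no two chords `(aᵢ, bᵢ, cᵢ, dᵢ)`, `(aⱼ, bⱼ, cⱼ, dⱼ)` satisfy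
`aᵢ < aⱼ < cᵢ < cⱼ` (noncrossing). -/
def IsChordDiagram (n k : ℕ) (D : Finset (ℕ × ℕ × ℕ × ℕ)) : Prop :=
  D.card = k ∧
  (∀ q ∈ D, q.2.1 = q.1 + 1 ∧ q.2.2.2 = q.2.2.1 + 1 ∧
      1 ≤ q.1 ∧ q.1 < q.2.1 ∧ q.2.1 < q.2.2.1 ∧ q.2.2.1 < q.2.2.2 ∧
      q.2.2.2 ≤ n - 1) ∧
  (∀ p ∈ D, ∀ q ∈ D, p ≠ q → p.1 ≠ q.1) ∧
  (∀ p ∈ D, ∀ q ∈ D, ¬(p.1 < q.1 ∧ q.1 < p.2.2.1 ∧ p.2.2.1 < q.2.2.1))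

/-- The chord diagrams of `CD_{n,k}` all of whose chords start at `b` or later. -/
noncomputable def diagramsFrom (n b k : ℕ) : Finset (Finset (ℕ × ℕ × ℕ × ℕ)) :=
  open Classical in
  (Finset.range n ×ˢ Finset.range n ×ˢ Finset.range n ×ˢ Finset.range n).powerset.filter
    fun D => IsChordDiagram n k D ∧ ∀ q ∈ D, b ≤ q.1

/-- The possible third entries of a nontrivial chord starting at `b - 1` which crosses no chord of
the diagram `D`, if all chords of `D` start at `b` or later. -/
def openEnds (n b : ℕ) (D : Finset (ℕ × ℕ × ℕ × ℕ)) : Finset ℕ :=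
  (Finset.Icc (b + 1) (n - 2)).filter fun c => ∀ q ∈ D, ¬(q.1 < c ∧ c < q.2.2.1)

/-- The number of diagrams with `k` chords on `j` possible starting points that have `s`
open ends. -/
def refinedNarayana (j s : ℕ) : ℕ → ℚ
  | 0 => if s = j then 1 else 0
  | k + 1 => if s < j then (s : ℚ) / j * j.choose (k + 1) * (j - s - 1).choose k else 0

theorem mem_diagramsFrom {n b k : ℕ} {D : Finset (ℕ × ℕ × ℕ × ℕ)} :
    D ∈ diagramsFrom n b k ↔ IsChordDiagram n k D ∧ ∀ q ∈ D, b ≤ q.1 := by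
  simp only [diagramsFrom, Finset.mem_filter, Finset.mem_powerset, and_iff_right_iff_imp]
  rintro ⟨⟨-, h, -⟩, -⟩ q hq
  have := h q hq
  simp only [Finset.mem_product, Finset.mem_range]
  omega

theorem sum_card_filter_ge (A : Finset ℕ) (g : ℕ → ℚ) :
    ∑ c ∈ A, g (A.filter (c ≤ ·)).card = ∑ i ∈ Finset.range A.card, g (i + 1) := by
  induction A using Finset.induction_on_min with
  | empty => simp
  | insert a A ha ih =>
    have hna : a ∉ A := fun h => lt_irrefl _ (ha a h)
    rw [Finset.sum_insert hna, Finset.card_insert_of_notMem hna, Finset.sum_range_succ, ← ih,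
      add_comm]
    congr 1
    · refine Finset.sum_congr rfl fun c hc => ?_
      rw [Finset.filter_insert, if_neg (by have := ha c hc; omega)]
    · rw [Finset.filter_true_of_mem, Finset.card_insert_of_notMem hna]
      intro x hx
      rcases Finset.mem_insert.1 hx with rfl | hx
      · exact le_rfl
      · exact (ha x hx).le

theorem openEnds_card_of_starts_gt {n b : ℕ} {D : Finset (ℕ × ℕ × ℕ × ℕ)} (hb : b + 3 ≤ n)
    (hD : ∀ q ∈ D, b + 1 ≤ q.1) :
    (openEnds n b D).card = (openEnds n (b + 1) D).card + 1 := by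
  have : openEnds n b D = insert (b + 1) (openEnds n (b + 1) D) := by
    ext c
    simp only [openEnds, Finset.mem_filter, Finset.mem_Icc, Finset.mem_insert]
    constructor
    · rintro ⟨h1, h2⟩
      by_cases hc : c = b + 1
      · exact Or.inl hc
      · exact Or.inr ⟨by omega, h2⟩
    · rintro (rfl | ⟨h1, h2⟩)
      · exact ⟨by omega, fun q hq => by have := hD q hq; omega⟩
      · exact ⟨by omega, h2⟩
  rw [this, Finset.card_insert_of_notMem (by simp [openEnds])]

theorem openEnds_insert {n b c : ℕ} {D : Finset (ℕ × ℕ × ℕ × ℕ)}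
    (hc : c ∈ openEnds n (b + 1) D) :
    openEnds n b (insert (b, b + 1, c, c + 1) D) =
      (openEnds n (b + 1) D).filter (c ≤ ·) := by
  simp only [openEnds, Finset.mem_filter, Finset.mem_Icc] at hc
  ext e
  simp only [openEnds, Finset.mem_filter, Finset.mem_Icc, Finset.forall_mem_insert]
  constructor
  · rintro ⟨h1, h2, h3⟩
    exact ⟨⟨by omega, h3⟩, by omega⟩
  · rintro ⟨⟨h1, h3⟩, h2⟩
    exact ⟨by omega, by omega, h3⟩

theorem insert_mem_diagramsFrom {n b c k : ℕ} {D : Finset (ℕ × ℕ × ℕ × ℕ)} (hb : 1 ≤ b)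
    (hD : D ∈ diagramsFrom n (b + 1) k) (hc : c ∈ openEnds n (b + 1) D) :
    insert (b, b + 1, c, c + 1) D ∈ diagramsFrom n b (k + 1) := by
  rw [mem_diagramsFrom] at hD ⊢
  obtain ⟨⟨h1, h2, h3, h4⟩, h5⟩ := hD
  simp only [openEnds, Finset.mem_filter, Finset.mem_Icc] at hc
  obtain ⟨hc1, hc2⟩ := hc
  have hn : (b, b + 1, c, c + 1) ∉ D := fun h => by have := h5 _ h; simp at this
  refine ⟨⟨by rw [Finset.card_insert_of_notMem hn, h1], ?_, ?_, ?_⟩, ?_⟩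
  · rw [Finset.forall_mem_insert]
    exact ⟨by dsimp only; omega, h2⟩
  · simp only [Finset.forall_mem_insert]
    refine ⟨⟨by simp, fun q hq _ => ?_⟩, fun p hp => ⟨fun _ => ?_, h3 p hp⟩⟩
    · have := h5 q hq; omega
    · have := h5 p hp; omega
  · simp only [Finset.forall_mem_insert]
    refine ⟨⟨by omega, fun q hq => ?_⟩, fun p hp => ⟨?_, h4 p hp⟩⟩
    · have := hc2 q hq; omega
    · have := h5 p hp; omega
  · rw [Finset.forall_mem_insert]
    exact ⟨le_rfl, fun q hq => by have := h5 q hq; omega⟩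

theorem erase_mem_diagramsFrom {n b k : ℕ} {D : Finset (ℕ × ℕ × ℕ × ℕ)}
    {p : ℕ × ℕ × ℕ × ℕ} (hD : D ∈ diagramsFrom n b (k + 1)) (hp : p ∈ D) (hpb : p.1 = b) :
    D.erase p ∈ diagramsFrom n (b + 1) k ∧ p.2.2.1 ∈ openEnds n (b + 1) (D.erase p) ∧
      p = (b, b + 1, p.2.2.1, p.2.2.1 + 1) := by
  rw [mem_diagramsFrom] at hD ⊢
  obtain ⟨⟨h1, h2, h3, h4⟩, h5⟩ := hD
  have hlt : ∀ q ∈ D.erase p, b + 1 ≤ q.1 := fun q hq => by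
    have h := h3 q (Finset.mem_of_mem_erase hq) p hp (Finset.ne_of_mem_erase hq)
    have := h5 q (Finset.mem_of_mem_erase hq)
    omega
  have h2p := h2 p hp
  refine ⟨⟨⟨by rw [Finset.card_erase_of_mem hp, h1]; rfl,
    fun q hq => h2 q (Finset.mem_of_mem_erase hq),
    fun q hq r hr => h3 q (Finset.mem_of_mem_erase hq) r (Finset.mem_of_mem_erase hr),
    fun q hq r hr => h4 q (Finset.mem_of_mem_erase hq) r (Finset.mem_of_mem_erase hr)⟩,
    hlt⟩, ?_, ?_⟩
  · simp only [openEnds, Finset.mem_filter, Finset.mem_Icc]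
    refine ⟨by omega, fun q hq => ?_⟩
    have := h4 p hp q (Finset.mem_of_mem_erase hq)
    have := hlt q hq
    omega
  · obtain ⟨x, y, z, w⟩ := p
    dsimp only at h2p hpb ⊢
    subst hpb
    rw [h2p.1, h2p.2.1]

theorem sum_diagramsFrom_succ {n b : ℕ} (k : ℕ) (hb : 1 ≤ b) (hn : b + 3 ≤ n) (g : ℕ → ℚ) :
    ∑ D ∈ diagramsFrom n b (k + 1), g (openEnds n b D).card =
      ∑ D ∈ diagramsFrom n (b + 1) (k + 1), g ((openEnds n (b + 1) D).card + 1) +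
      ∑ D ∈ diagramsFrom n (b + 1) k,
        ∑ i ∈ Finset.range (openEnds n (b + 1) D).card, g (i + 1) := by
  classical
  rw [← Finset.sum_filter_add_sum_filter_not _ (fun D => ∀ q ∈ D, b + 1 ≤ q.1)]
  congr 1
  · have : (diagramsFrom n b (k + 1)).filter (fun D => ∀ q ∈ D, b + 1 ≤ q.1) =
        diagramsFrom n (b + 1) (k + 1) := by
      ext D
      simp only [Finset.mem_filter, mem_diagramsFrom]
      exact ⟨fun h => ⟨h.1.1, h.2⟩, fun h => ⟨⟨h.1, fun q hq => Nat.le_of_succ_le (h.2 q hq)⟩, h.2⟩⟩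
    rw [this]
    refine Finset.sum_congr rfl fun D hD => ?_
    rw [openEnds_card_of_starts_gt hn (mem_diagramsFrom.1 hD).2]
  · simp_rw [← sum_card_filter_ge]
    rw [Finset.sum_sigma']
    symm
    refine Finset.sum_bij (fun x _ => insert (b, b + 1, x.2, x.2 + 1) x.1) ?_ ?_ ?_ ?_
    · rintro ⟨D, c⟩ h
      rw [Finset.mem_sigma] at h
      refine Finset.mem_filter.2 ⟨insert_mem_diagramsFrom hb h.1 h.2, fun h' => ?_⟩
      have := h' _ (Finset.mem_insert_self _ _)
      simp at this
    · rintro ⟨D, c⟩ h ⟨D', c'⟩ h' heq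
      rw [Finset.mem_sigma] at h h'
      have hD := (mem_diagramsFrom.1 h.1).2
      have hD' := (mem_diagramsFrom.1 h'.1).2
      dsimp only at hD hD' heq
      have hnot : ∀ (E : Finset (ℕ × ℕ × ℕ × ℕ)) (e : ℕ), (∀ q ∈ E, b + 1 ≤ q.1) →
          (b, b + 1, e, e + 1) ∉ E := fun E e hE h => by have := hE _ h; simp at this
      have hc : c = c' := by
        have hmem := heq ▸ Finset.mem_insert_self (b, b + 1, c, c + 1) D
        rcases Finset.mem_insert.1 hmem with h | h
        · simpa using h
        · exact absurd h (hnot D' c hD')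
      subst hc
      have hDD : D = D' := by
        rw [← Finset.erase_insert (hnot D c hD), heq, Finset.erase_insert (hnot D' c hD')]
      rw [hDD]
    · intro D hD
      obtain ⟨hD, hs⟩ := Finset.mem_filter.1 hD
      push Not at hs
      obtain ⟨p, hp, hpb⟩ := hs
      have hpb' : p.1 = b := by
        have := (mem_diagramsFrom.1 hD).2 p hp
        omega
      obtain ⟨h1, h2, h3⟩ := erase_mem_diagramsFrom hD hp hpb'
      refine ⟨⟨D.erase p, p.2.2.1⟩, Finset.mem_sigma.2 ⟨h1, h2⟩, ?_⟩
      dsimp only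
      rw [← h3, Finset.insert_erase hp]
    · rintro ⟨D, c⟩ h
      rw [Finset.mem_sigma] at h
      rw [openEnds_insert h.2]

theorem diagramsFrom_zero (n b : ℕ) : diagramsFrom n b 0 = {∅} := by
  ext D
  rw [mem_diagramsFrom, Finset.mem_singleton]
  constructor
  · rintro ⟨⟨h, -⟩, -⟩
    exact Finset.card_eq_zero.1 h
  · rintro rfl
    simp [IsChordDiagram]

theorem refinedNarayana_sub_sub {j s k : ℕ} (hs : s < j) :
    (refinedNarayana (j + 1) (s + 1) (k + 1) - refinedNarayana j s (k + 1)) -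
      (refinedNarayana (j + 1) (s + 2) (k + 1) - refinedNarayana j (s + 1) (k + 1)) =
      refinedNarayana j (s + 1) k := by
  obtain ⟨p, rfl⟩ := Nat.exists_eq_add_of_lt hs
  have hj : ((s : ℚ) + p + 1) ≠ 0 := by positivity
  have hj' : ((s : ℚ) + p + 1 + 1) ≠ 0 := by positivity
  have hk' : ((k : ℚ) + 1) ≠ 0 := by positivity
  have e1 : (((s + p + 1 + 1).choose (k + 1) : ℕ) : ℚ) =
      (s + p + 1 + 1) / (k + 1) * ((s + p + 1).choose k : ℕ) := by
    have h := Nat.add_one_mul_choose_eq (s + p + 1) k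
    have h : ((s : ℚ) + p + 1 + 1) * ((s + p + 1).choose k : ℕ) =
      ((s + p + 1 + 1).choose (k + 1) : ℕ) * (k + 1) := by exact_mod_cast h
    field_simp
    linarith
  have e2 : (((s + p + 1).choose (k + 1) : ℕ) : ℚ) =
      (s + p + 1 - k) / (k + 1) * ((s + p + 1).choose k : ℕ) := by
    have h := Nat.choose_succ_succ (s + p + 1) k
    have h : (((s + p + 1 + 1).choose (k + 1) : ℕ) : ℚ) = ((s + p + 1).choose k : ℕ) +
      ((s + p + 1).choose (k + 1) : ℕ) := by exact_mod_cast h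
    rw [e1] at h
    rw [← sub_eq_iff_eq_add'.2 h]
    field_simp
    ring
  rcases p with - | p
  · rcases k with - | k
    · simp [refinedNarayana] at hj hj' ⊢
      field_simp
      ring
    · simp [refinedNarayana]
  · have r1 : s + (p + 1) + 1 + 1 - (s + 1) - 1 = p + 1 := by omega
    have r2 : s + (p + 1) + 1 - s - 1 = p + 1 := by omega
    have r3 : s + (p + 1) + 1 + 1 - (s + 2) - 1 = p := by omega
    have r4 : s + (p + 1) + 1 - (s + 1) - 1 = p := by omega
    have l1 : s + 1 < s + (p + 1) + 1 + 1 := by omega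
    have l2 : s + 2 < s + (p + 1) + 1 + 1 := by omega
    have l3 : s + 1 < s + (p + 1) + 1 := by omega
    rcases k with - | k
    · have l4 : s + 1 ≠ s + (p + 1) + 1 := by omega
      simp only [refinedNarayana, if_pos hs, if_pos l1, if_pos l2, if_pos l3, if_neg l4,
        Nat.choose_zero_right, zero_add, Nat.choose_one_right]
      push_cast at hj hj' ⊢
      field_simp
      ring
    · simp only [refinedNarayana, if_pos hs, if_pos l1, if_pos l2, if_pos l3, r1, r2, r3, r4,
        e1, e2]
      have e3 : ((p + 1).choose (k + 1) : ℚ) = p.choose k + p.choose (k + 1) := by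
        exact_mod_cast Nat.choose_succ_succ p k
      have e4 : (p.choose (k + 1) : ℚ) = (p - k) / (k + 1) * p.choose k := by
        have h := Nat.add_one_mul_choose_eq p k
        have h : ((p : ℚ) + 1) * p.choose k = (p + 1).choose (k + 1) * (k + 1) := by
          exact_mod_cast h
        rw [e3] at h
        have : (k : ℚ) + 1 ≠ 0 := by positivity
        field_simp
        linarith
      rw [e3, e4]
      have : (k : ℚ) + 1 ≠ 0 := by positivity
      push_cast at hj hj' hk' ⊢
      field_simp
      ring

theorem sum_refinedNarayana {j s k : ℕ} (hs : s ≤ j) :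
    ∑ i ∈ Finset.Icc (s + 1) j, refinedNarayana j i k =
      refinedNarayana (j + 1) (s + 1) (k + 1) - refinedNarayana j s (k + 1) := by
  induction hs using Nat.decreasingInduction with
  | self => simp [refinedNarayana]
  | of_succ s hs ih =>
    rw [← Finset.add_sum_Ioc_eq_sum_Icc (by omega), ← refinedNarayana_sub_sub hs]
    have : Finset.Ioc (s + 1) j = Finset.Icc (s + 1 + 1) j := by
      ext; simp only [Finset.mem_Ioc, Finset.mem_Icc]; omega
    rw [this, ih]
    ring

theorem sum_refinedNarayana_succ_mul (j k : ℕ) (g : ℕ → ℚ) :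
    ∑ s ∈ Finset.range (j + 2), refinedNarayana (j + 1) s (k + 1) * g s =
      ∑ s ∈ Finset.range (j + 1), refinedNarayana j s (k + 1) * g (s + 1) +
      ∑ s ∈ Finset.range (j + 1),
        refinedNarayana j s k * ∑ i ∈ Finset.range s, g (i + 1) := by
  rw [Finset.sum_range_succ']
  simp_rw [Finset.mul_sum]
  rw [Finset.sum_comm' (t' := Finset.range (j + 1)) (s' := fun i => Finset.Icc (i + 1) j)
    (by intro x y; simp only [Finset.mem_range, Finset.mem_Icc]; omega),
    ← Finset.sum_add_distrib]
  have h0 : refinedNarayana (j + 1) 0 (k + 1) = 0 := by simp [refinedNarayana]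
  rw [h0, zero_mul, add_zero]
  refine Finset.sum_congr rfl fun s hs => ?_
  rw [← Finset.sum_mul, sum_refinedNarayana (Finset.mem_range_succ_iff.1 hs)]
  ring

theorem sum_diagramsFrom (j k b : ℕ) (hb : 1 ≤ b) (g : ℕ → ℚ) :
    ∑ D ∈ diagramsFrom (b + j + 2) b k, g (openEnds (b + j + 2) b D).card =
      ∑ s ∈ Finset.range (j + 1), refinedNarayana j s k * g s := by
  induction j generalizing k b g with
  | zero =>
    rcases k with - | k
    · simp [diagramsFrom_zero, openEnds, refinedNarayana]
    · have : diagramsFrom (b + 0 + 2) b (k + 1) = ∅ := by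
        refine Finset.eq_empty_of_forall_notMem fun D hD => ?_
        obtain ⟨⟨h1, h2, -⟩, h3⟩ := mem_diagramsFrom.1 hD
        obtain ⟨q, hq⟩ := Finset.card_pos.1 (by omega : 0 < D.card)
        have := h2 q hq
        have := h3 q hq
        omega
      simp [this, refinedNarayana]
  | succ j ih =>
    rcases k with - | k
    · have : b + (j + 1) - b = j + 1 := by omega
      simp [diagramsFrom_zero, openEnds, refinedNarayana, this]
    · have e : b + (j + 1) + 2 = b + 1 + j + 2 := by ring
      rw [sum_diagramsFrom_succ k hb (by omega), e, ih (k + 1) (b + 1) (by omega)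
        (fun s => g (s + 1)), ih k (b + 1) (by omega) (fun s => ∑ i ∈ Finset.range s, g (i + 1)),
        sum_refinedNarayana_succ_mul]

/-- The number of chord diagrams with `n` markers and `k` chords is the Narayana
number `N(n-3, k+1) = (1/(k+1)) · C(n-4, k) · C(n-3, k)`. -/
theorem chordDiagram_count (n k : ℕ) (hn : 4 ≤ n) :
    (Set.ncard {D : Finset (ℕ × ℕ × ℕ × ℕ) | IsChordDiagram n k D} : ℚ) =
      ((n - 4).choose k * (n - 3).choose k : ℚ) / ((k : ℚ) + 1) := by
  obtain ⟨m, rfl⟩ := Nat.exists_eq_add_of_le hn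
  have hset : {D : Finset (ℕ × ℕ × ℕ × ℕ) | IsChordDiagram (4 + m) k D} =
      (diagramsFrom (4 + m) 1 k : Set (Finset (ℕ × ℕ × ℕ × ℕ))) := by
    ext D
    rw [Finset.mem_coe, mem_diagramsFrom, Set.mem_ofPred_eq]
    exact ⟨fun h => ⟨h, fun q hq => (h.2.1 q hq).2.2.1⟩, fun h => h.1⟩
  have h := sum_diagramsFrom (m + 1) k 1 le_rfl fun _ => 1
  have h0 : refinedNarayana (m + 1) 0 k = 0 := by
    rcases k with - | k <;> simp [refinedNarayana]
  have h1 : refinedNarayana (m + 1) 0 (k + 1) = 0 := by simp [refinedNarayana]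
  have hrange : Finset.range (m + 1 + 1) = insert 0 (Finset.Icc (0 + 1) (m + 1)) := by
    ext; simp only [Finset.mem_range, Finset.mem_insert, Finset.mem_Icc]; omega
  rw [show 1 + (m + 1) + 2 = 4 + m by ring] at h
  simp only [mul_one, Finset.sum_const, nsmul_eq_mul] at h
  rw [hrange, Finset.sum_insert (by simp), h0, zero_add, sum_refinedNarayana (Nat.zero_le _), h1,
    sub_zero] at h
  rw [hset, Set.ncard_coe_finset, h]
  have e1 : 4 + m - 4 = m := by omega
  have e2 : 4 + m - 3 = m + 1 := by omega
  have e3 : m + 1 + 1 - (0 + 1) - 1 = m := by omega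
  have hc : ((m : ℚ) + 1 + 1) * (m + 1).choose k = (m + 1 + 1).choose (k + 1) * (k + 1) := by
    exact_mod_cast Nat.add_one_mul_choose_eq (m + 1) k
  rw [e1, e2, refinedNarayana, if_pos (by omega), e3]
  push_cast
  field_simp
  linear_combination (-(m.choose k : ℚ)) * hc
end

section
/- The amplituhedron map is well defined on the spurion cell: for every Z ∈ Mat^{>0}_{9,6} (a 9×6 real matrix all of whose 6×6 minors are positive) and every C in the spurion cell S_sp ⊆ Mat_{2,9}(ℝ), the 2×6 matrix CZ has rank 2. -/
open Finset

/-- The `2 × 2` minor `⟨{i,j}⟩_C` of a `2 × 9` matrix on columns `i` and `j`. -/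
noncomputable def minor2 (C : Matrix (Fin 2) (Fin 9) ℝ) (i j : Fin 9) : ℝ :=
  C 0 i * C 1 j - C 0 j * C 1 i

/-- The spurion cell `S_sp ⊆ Mat_{2,9}(ℝ)`: the `2 × 2` minor on columns `i < j`
vanishes when `i` and `j` lie in the same block of `{1,2,3}, {4,5,6}, {7,8,9}`
(`0`-based: blocks of `⌊·/3⌋`), and is strictly positive when they lie in
different blocks. -/
def SpurionCell (C : Matrix (Fin 2) (Fin 9) ℝ) : Prop :=
  ∀ i j : Fin 9, i < j →
    (((i : ℕ) / 3 = (j : ℕ) / 3 → minor2 C i j = 0) ∧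
     ((i : ℕ) / 3 ≠ (j : ℕ) / 3 → 0 < minor2 C i j))

/-- The `6 × 6` minor of a `9 × 6` matrix `Z` on the rows indexed by `S`,
taken in increasing order (junk value `0` if `S.card ≠ 6`). -/
noncomputable def rowMinor (Z : Matrix (Fin 9) (Fin 6) ℝ) (S : Finset (Fin 9)) : ℝ :=
  if h : S.card = 6 then (Z.submatrix ⇑(S.orderEmbOfFin h) id).det else 0

/-- `Mat^{>0}_{9,6}`: all `6 × 6` minors are positive. -/
def PosMat (Z : Matrix (Fin 9) (Fin 6) ℝ) : Prop :=
  ∀ S : Finset (Fin 9), S.card = 6 → 0 < rowMinor Z S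

/-- Every maximal minor of a totally positive matrix, on rows listed increasingly, is positive. -/
theorem PosMat.det_submatrix_pos {Z : Matrix (Fin 9) (Fin 6) ℝ} (hZ : PosMat Z)
    {k : Fin 6 → Fin 9} (hk : StrictMono k) : 0 < (Z.submatrix k id).det := by
  have hc : (univ.image k).card = 6 := by
    rw [card_image_of_injective _ hk.injective, card_univ, Fintype.card_fin]
  have h := hZ _ hc
  have e : k = (univ.image k).orderEmbOfFin hc :=
    orderEmbOfFin_unique hc (fun i => mem_image_of_mem k (mem_univ i)) hk
  rw [rowMinor, dif_pos hc, ← e] at h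
  exact h

/-- The `6 × 6` determinant as an alternating form in the rows. -/
noncomputable def detForm : (Fin 6 → ℝ) [⋀^Fin 6]→ₗ[ℝ] ℝ :=
  Matrix.detRowAlternating

/-- The determinant with rows `Z 0, …, Z 3, u, v`, as a linear function of `u`. -/
noncomputable def detAppendTwo (Z : Matrix (Fin 9) (Fin 6) ℝ) (v : Fin 6 → ℝ) :
    (Fin 6 → ℝ) →ₗ[ℝ] ℝ :=
  detForm.toMultilinearMap.toLinearMap ![Z 0, Z 1, Z 2, Z 3, 0, v] 4

theorem detAppendTwo_apply (Z : Matrix (Fin 9) (Fin 6) ℝ) (u v : Fin 6 → ℝ) :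
    detAppendTwo Z v u = detForm ![Z 0, Z 1, Z 2, Z 3, u, v] := by
  have h : Function.update ![Z 0, Z 1, Z 2, Z 3, 0, v] 4 u = ![Z 0, Z 1, Z 2, Z 3, u, v] := by
    funext i
    fin_cases i <;> rfl
  rw [detAppendTwo, MultilinearMap.toLinearMap_apply, AlternatingMap.coe_multilinearMap, h]

theorem detAppendTwo_self (Z : Matrix (Fin 9) (Fin 6) ℝ) (v : Fin 6 → ℝ) :
    detAppendTwo Z v v = 0 := by
  rw [detAppendTwo_apply]
  exact AlternatingMap.map_eq_zero_of_eq _ _ (i := 4) (j := 5) rfl (by decide)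

theorem detAppendTwo_swap (Z : Matrix (Fin 9) (Fin 6) ℝ) (u v : Fin 6 → ℝ) :
    detAppendTwo Z v u = -detAppendTwo Z u v := by
  have h := detForm.map_swap ![Z 0, Z 1, Z 2, Z 3, v, u]
    (show (4 : Fin 6) ≠ 5 by decide)
  have e : ![Z 0, Z 1, Z 2, Z 3, v, u] ∘ Equiv.swap (4 : Fin 6) 5 =
      ![Z 0, Z 1, Z 2, Z 3, u, v] := by
    funext i
    fin_cases i <;> rfl
  rw [detAppendTwo_apply, detAppendTwo_apply, ← h, e]

theorem detAppendTwo_row (Z : Matrix (Fin 9) (Fin 6) ℝ) (v : Fin 6 → ℝ) :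
    detAppendTwo Z v (Z 0) = 0 ∧ detAppendTwo Z v (Z 1) = 0 ∧
      detAppendTwo Z v (Z 2) = 0 ∧ detAppendTwo Z v (Z 3) = 0 := by
  simp only [detAppendTwo_apply]
  exact ⟨AlternatingMap.map_eq_zero_of_eq _ _ (i := 4) (j := 0) rfl (by decide),
    AlternatingMap.map_eq_zero_of_eq _ _ (i := 4) (j := 1) rfl (by decide),
    AlternatingMap.map_eq_zero_of_eq _ _ (i := 4) (j := 2) rfl (by decide),
    AlternatingMap.map_eq_zero_of_eq _ _ (i := 4) (j := 3) rfl (by decide)⟩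

theorem PosMat.detAppendTwo_pos {Z : Matrix (Fin 9) (Fin 6) ℝ} (hZ : PosMat Z) {b c : Fin 9}
    (hb : 3 < b) (hbc : b < c) : 0 < detAppendTwo Z (Z c) (Z b) := by
  have hk : StrictMono ![0, 1, 2, 3, b, c] := by
    rw [Fin.strictMono_iff_lt_succ]
    intro i
    fin_cases i
    exacts [(by decide : (0 : Fin 9) < 1), (by decide : (1 : Fin 9) < 2),
      (by decide : (2 : Fin 9) < 3), hb, hbc]
  have h := hZ.det_submatrix_pos hk
  rw [detAppendTwo_apply]
  convert h using 1
  change Matrix.det _ = _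
  congr 1
  funext i
  fin_cases i <;> rfl

theorem sum_univ_fin_nine {M : Type*} [AddCommMonoid M] (g : Fin 9 → M) :
    ∑ i, g i = g 0 + g 1 + g 2 + g 3 + g 4 + g 5 + g 6 + g 7 + g 8 := by
  rw [Fin.sum_univ_castSucc, Fin.sum_univ_eight]
  rfl

/-- If positive combinations of rows `4, 5` and of rows `6, 7, 8` are scaled by `s` and `t` so as
to cancel modulo rows `0, …, 3`, then `s = t = 0`. -/
theorem PosMat.eq_zero_of_sum_eq_zero {Z : Matrix (Fin 9) (Fin 6) ℝ} (hZ : PosMat Z)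
    {a x : Fin 9 → ℝ} {s t : ℝ} (ha : ∀ i, 3 < i → 0 < a i)
    (h4 : x 4 = s * a 4) (h5 : x 5 = s * a 5) (h6 : x 6 = t * a 6) (h7 : x 7 = t * a 7)
    (h8 : x 8 = t * a 8) (hx : ∑ i, x i • Z i = 0) : s = 0 ∧ t = 0 := by
  set p := a 4 • Z 4 + a 5 • Z 5 with hp
  set q := a 6 • Z 6 + a 7 • Z 7 + a 8 • Z 8 with hq
  have hpq : 0 < detAppendTwo Z q p := by
    have hpos : ∀ b c : Fin 9, 3 < b → b < c → 0 < a b * (a c * detAppendTwo Z (Z c) (Z b)) :=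
      fun b c hb hbc => mul_pos (ha b hb) (mul_pos (ha c (hb.trans hbc))
        (hZ.detAppendTwo_pos hb hbc))
    have expand : ∀ u, detAppendTwo Z q u = a 6 * detAppendTwo Z (Z 6) u +
        a 7 * detAppendTwo Z (Z 7) u + a 8 * detAppendTwo Z (Z 8) u := by
      intro u
      rw [detAppendTwo_swap, hq, detAppendTwo_swap Z u (Z 6), detAppendTwo_swap Z u (Z 7),
        detAppendTwo_swap Z u (Z 8)]
      simp only [map_add, map_smul, smul_eq_mul]
      ring
    have e : detAppendTwo Z q p = a 4 * detAppendTwo Z q (Z 4) + a 5 * detAppendTwo Z q (Z 5) := by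
      simp only [hp, map_add, map_smul, smul_eq_mul]
    rw [e, expand, expand]
    linarith [hpos 4 6 (by decide) (by decide), hpos 4 7 (by decide) (by decide),
      hpos 4 8 (by decide) (by decide), hpos 5 6 (by decide) (by decide),
      hpos 5 7 (by decide) (by decide), hpos 5 8 (by decide) (by decide)]
  have key : ∀ v, s * detAppendTwo Z v p + t * detAppendTwo Z v q = 0 := by
    intro v
    obtain ⟨r0, r1, r2, r3⟩ := detAppendTwo_row Z v
    have h := congrArg (detAppendTwo Z v) hx
    rw [map_sum, map_zero, sum_univ_fin_nine] at h
    simp only [map_smul, smul_eq_mul] at h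
    rw [r0, r1, r2, r3, h4, h5, h6, h7, h8] at h
    simp only [hp, hq, map_add, map_smul, smul_eq_mul]
    linear_combination h
  constructor
  · have h := key q
    rw [detAppendTwo_self, mul_zero, add_zero] at h
    exact (mul_eq_zero.mp h).resolve_right hpq.ne'
  · have h := key p
    rw [detAppendTwo_self, mul_zero, zero_add, detAppendTwo_swap] at h
    exact (mul_eq_zero.mp h).resolve_right (neg_ne_zero.mpr hpq.ne')

/-- The amplituhedron map is well defined on the spurion cell: for any totally
positive `Z` and any `C` in the spurion cell, `C * Z` has rank `2`. -/
theorem spurion_amplituhedron_map_well_defined (Z : Matrix (Fin 9) (Fin 6) ℝ)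
    (hZ : PosMat Z) (C : Matrix (Fin 2) (Fin 9) ℝ) (hC : SpurionCell C) :
    (C * Z).rank = 2 := by
  suffices hinj : ∀ y : Fin 2 → ℝ, Matrix.vecMul y (C * Z) = 0 → y = 0 by
    have hli : LinearIndependent ℝ (C * Z).row :=
      Matrix.vecMul_injective_iff.mp ((injective_iff_map_eq_zero (C * Z).vecMulLinear).mpr hinj)
    simpa using hli.rank_matrix
  intro y hy
  set x := Matrix.vecMul y C with hxdef
  have hxi : ∀ i, x i = y 0 * C 0 i + y 1 * C 1 i := fun i => by
    simp [hxdef, Matrix.vecMul, dotProduct, Fin.sum_univ_two]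
  have hx : ∑ i, x i • Z i = 0 := by
    rw [← Matrix.vecMul_eq_sum, hxdef, Matrix.vecMul_vecMul, hy]
  have ha : ∀ i : Fin 9, 3 < i → 0 < minor2 C 0 i := by
    intro i hi
    refine (hC 0 i (by omega)).2 ?_
    simp only [Fin.lt_def, Fin.val_zero] at hi ⊢
    change 3 < (i : ℕ) at hi
    omega
  have hprop : ∀ i j : Fin 9, i < j → 3 < i → (i : ℕ) / 3 = (j : ℕ) / 3 →
      x j = x i / minor2 C 0 i * minor2 C 0 j := by
    intro i j hij hi hdiv
    have hm := (hC i j hij).1 hdiv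
    rw [div_mul_eq_mul_div, eq_div_iff (ha i hi).ne', hxi, hxi]
    unfold minor2 at hm ⊢
    linear_combination -(y 0 * C 0 0 + y 1 * C 1 0) * hm
  have hself : ∀ i : Fin 9, 3 < i → x i = x i / minor2 C 0 i * minor2 C 0 i :=
    fun i hi => (div_mul_cancel₀ _ (ha i hi).ne').symm
  obtain ⟨hs, ht⟩ := hZ.eq_zero_of_sum_eq_zero ha (hself 4 (by decide))
    (hprop 4 5 (by decide) (by decide) (by decide)) (hself 6 (by decide))
    (hprop 6 7 (by decide) (by decide) (by decide))
    (hprop 6 8 (by decide) (by decide) (by decide)) hx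
  have h4 := (div_eq_zero_iff.mp hs).resolve_right (ha 4 (by decide)).ne'
  have h6 := (div_eq_zero_iff.mp ht).resolve_right (ha 6 (by decide)).ne'
  have hm := (hC 4 6 (by decide)).2 (by decide)
  rw [hxi] at h4 h6
  unfold minor2 at hm
  funext i
  refine (mul_eq_zero.mp ?_).resolve_right hm.ne'
  fin_cases i
  · change y 0 * _ = 0
    linear_combination C 1 6 * h4 - C 1 4 * h6
  · change y 1 * _ = 0
    linear_combination C 0 4 * h6 - C 0 6 * h4
end

section
/- The amplituhedron map is injective on the spurion cell, so its image is a tile of the amplituhedron A_{9,2,4}(Z): for every Z ∈ Mat^{>0}_{9,6} and all C, C′ in the spurion cell S_sp ⊆ Mat_{2,9}(ℝ), if the 2×6 matrices CZ and C′Z have the same row span in ℝ^6, then C and C′ have the same row span in ℝ^9. -/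
open Finset

/-- The span of the rows of a matrix. -/
def rowSpan {m n : ℕ} (M : Matrix (Fin m) (Fin n) ℝ) : Submodule ℝ (Fin n → ℝ) :=
  Submodule.span ℝ (Set.range fun i => M i)

lemma Matrix.det_mul_eq_sum {m n R : Type*} [Fintype m] [DecidableEq m] [Fintype n]
    [DecidableEq n] [CommRing R] (M : Matrix n m R) (N : Matrix m n R) :
    (M * N).det = ∑ s : n → m, (∏ k, M k (s k)) * (N.submatrix s id).det := by
  have hrows : M * N = fun k => ∑ i, M k i • N i := by
    ext k j
    simp [Matrix.mul_apply]
  have hsum := (Matrix.detRowAlternating (n := n) (R := R)).toMultilinearMap.map_sum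
    fun k i => M k i • N i
  rw [hrows]
  refine Eq.trans hsum (sum_congr rfl fun s _ => ?_)
  exact MultilinearMap.map_smul_univ _ (fun k => M k (s k)) fun k => N (s k)

namespace PosMat

variable {Z : Matrix (Fin 9) (Fin 6) ℝ} {x : Fin 9 → ℝ}

lemma det_submatrix_pos_s10 (hZ : PosMat Z) {s : Fin 6 → Fin 9} (hs : StrictMono s) :
    0 < (Z.submatrix s id).det := by
  have hcard : (univ.image s).card = 6 := by
    rw [card_image_of_injective _ hs.injective]; simp
  have h := hZ _ hcard
  rw [rowMinor, dif_pos hcard] at h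
  rwa [← orderEmbOfFin_unique hcard (fun k => mem_image_of_mem s (mem_univ k)) hs] at h

lemma det_mul_pos (hZ : PosMat Z) {f : Fin 9 → Fin 6} (hf : Monotone f)
    {M : Matrix (Fin 6) (Fin 9) ℝ} (hM : ∀ k i, 0 ≤ M k i) (hM₀ : ∀ k i, f i ≠ k → M k i = 0)
    (hM₁ : ∀ k, ∃ i, 0 < M k i) : 0 < (M * Z).det := by
  have mono : ∀ s : Fin 6 → Fin 9, (∀ k, M k (s k) ≠ 0) → StrictMono s := by
    intro s hs k l hkl
    have hfs : ∀ k, f (s k) = k := fun k => by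
      by_contra h
      exact hs k (hM₀ _ _ h)
    by_contra! h
    have := hf h
    rw [hfs, hfs] at this
    exact this.not_gt hkl
  rw [Matrix.det_mul_eq_sum]
  choose s hs using hM₁
  refine sum_pos' (fun t _ => ?_) ⟨s, mem_univ s, ?_⟩
  · by_cases ht : ∀ k, M k (t k) ≠ 0
    · exact mul_nonneg (prod_nonneg fun k _ => hM _ _) (hZ.det_submatrix_pos_s10 (mono t ht)).le
    · push Not at ht
      obtain ⟨k, hk⟩ := ht
      rw [prod_eq_zero (mem_univ k) hk, zero_mul]
  · exact mul_pos (prod_pos fun k _ => hs k)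
      (hZ.det_submatrix_pos_s10 (mono s fun k => (hs k).ne'))

/-- A vector in the left kernel of a totally positive matrix vanishes if its entries split into
six intervals on each of which it has constant weak sign. -/
lemma eq_zero_of_mul_nonneg (hZ : PosMat Z) (hx : Matrix.vecMul x Z = 0) {f : Fin 9 → Fin 6}
    (hf : Monotone f) (hf' : Function.Surjective f) (h : ∀ i j, f i = f j → 0 ≤ x i * x j) :
    x = 0 := by
  have key : ∀ k, ∃ (t : ℝ) (c : Fin 9 → ℝ), (∀ i, 0 ≤ c i) ∧ (∃ i, f i = k ∧ 0 < c i) ∧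
      ∀ i, f i = k → x i = t * c i := by
    intro k
    by_cases hk : ∃ j, f j = k ∧ x j ≠ 0
    · obtain ⟨j, hj, hj'⟩ := hk
      refine ⟨x j / |x j|, fun i => |x i|, fun i => abs_nonneg _, ⟨j, hj, abs_pos.2 hj'⟩, ?_⟩
      intro i hi
      have hij := h i j (hi.trans hj.symm)
      have : x j * |x i| = |x j| * x i := by
        rcases lt_or_gt_of_ne hj' with hlt | hlt
        · rw [abs_of_neg hlt, abs_of_nonpos (by nlinarith)]; ring
        · rw [abs_of_pos hlt, abs_of_nonneg (by nlinarith)]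
      field_simp
      linarith
    · push Not at hk
      obtain ⟨i, hi⟩ := hf' k
      exact ⟨0, 1, fun i => zero_le_one, ⟨i, hi, zero_lt_one⟩, fun i hi => by simp [hk i hi]⟩
  choose t c hc hc₁ htc using key
  let M : Matrix (Fin 6) (Fin 9) ℝ := fun k i => if f i = k then c k i else 0
  have hdet : 0 < (M * Z).det := by
    refine hZ.det_mul_pos hf (fun k i => ?_) (fun k i hi => if_neg hi) (fun k => ?_)
    · simp only [M]
      split_ifs
      exacts [hc k i, le_rfl]
    · obtain ⟨i, hi, hi'⟩ := hc₁ k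
      exact ⟨i, by simpa [M, hi] using hi'⟩
  have hxM : Matrix.vecMul t M = x := by
    ext i
    simp [Matrix.vecMul, dotProduct, M, ← htc (f i) i rfl]
  have ht : t = 0 := Matrix.eq_zero_of_vecMul_eq_zero hdet.ne'
    (by rw [← Matrix.vecMul_vecMul, hxM, hx])
  rw [← hxM, ht, Matrix.zero_vecMul]

lemma eq_zero_of_adjacent_mul_nonneg (hZ : PosMat Z) (hx : Matrix.vecMul x Z = 0)
    {g : Fin 9 → Fin 7} (hg : Monotone g) (hg' : Function.Surjective g) {t : Fin 7 → ℝ}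
    {c : Fin 9 → ℝ} (hc : ∀ i, 0 < c i) (hxt : ∀ i, x i = t (g i) * c i) (k : Fin 6)
    (hk : 0 ≤ t k.castSucc * t k.succ) : x = 0 := by
  refine hZ.eq_zero_of_mul_nonneg hx (f := fun i => k.predAbove (g i))
    ((Fin.predAbove_right_monotone k).comp hg)
    ((Fin.predAbove_surjective k).comp hg') fun i j hij => ?_
  have hmerge : ∀ m n : Fin 7, k.predAbove m = k.predAbove n → 0 ≤ t m * t n := by
    intro m n hmn
    have hcases : ∀ (k : Fin 6) (m n : Fin 7), k.predAbove m = k.predAbove n →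
        m = n ∨ (m = k.castSucc ∧ n = k.succ) ∨ (m = k.succ ∧ n = k.castSucc) := by
      decide
    rcases hcases k m n hmn with rfl | ⟨rfl, rfl⟩ | ⟨rfl, rfl⟩
    · exact mul_self_nonneg _
    · exact hk
    · rwa [mul_comm]
  rw [hxt, hxt, mul_mul_mul_comm]
  exact mul_nonneg (hmerge _ _ hij) (mul_pos (hc i) (hc j)).le

end PosMat

/-- The block `⌊i / 3⌋` of a column index. -/
def colBlock (i : Fin 9) : Fin 3 := ⟨i / 3, by omega⟩

namespace SpurionCell

variable {C : Matrix (Fin 2) (Fin 9) ℝ}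

/-- The columns of a matrix in the spurion cell are positive multiples of three vectors of the
plane, one for each block. -/
lemma exists_factor (hC : SpurionCell C) :
    ∃ (a : Fin 9 → ℝ) (v : Fin 3 → Fin 2 → ℝ), (∀ i, 0 < a i) ∧
      (∀ k i, C k i = a i * v (colBlock i) k) ∧
      ∀ r s, r < s → 0 < v r 0 * v s 1 - v s 0 * v r 1 := by
  have col : ∀ i j l, minor2 C i j = 0 → 0 < minor2 C i l * minor2 C j l →
      0 < minor2 C i l / minor2 C j l ∧
        ∀ k, C k i = minor2 C i l / minor2 C j l * C k j := by
    intro i j l h0 hpos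
    have hj : minor2 C j l ≠ 0 := right_ne_zero_of_mul hpos.ne'
    refine ⟨div_pos_iff.2 (mul_pos_iff.1 hpos), fun k => ?_⟩
    · rw [div_mul_eq_mul_div, eq_div_iff hj]
      unfold minor2 at *
      fin_cases k <;> simp <;> grind
  let p : Fin 3 → Fin 9 := ![0, 3, 6]
  have hp₁ : ∀ i, i ≠ p (colBlock i) → p (colBlock i) < i := by decide
  have hp₂ : ∀ i, (p (colBlock i) : ℕ) / 3 = i / 3 := by decide
  have hp₃ : ∀ i : Fin 9, i < 6 → (i < 8 ∧ (i : ℕ) / 3 ≠ (8 : Fin 9) / 3) ∧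
      p (colBlock i) < 8 ∧ (p (colBlock i) : ℕ) / 3 ≠ (8 : Fin 9) / 3 := by decide
  have hp₄ : ∀ i : Fin 9, ¬ i < 6 → (0 < i ∧ ((0 : Fin 9) : ℕ) / 3 ≠ i / 3) ∧
      0 < p (colBlock i) ∧ ((0 : Fin 9) : ℕ) / 3 ≠ p (colBlock i) / 3 := by decide
  have hp₅ : ∀ r s, r < s → p r < p s ∧ (p r : ℕ) / 3 ≠ p s / 3 := by decide
  have key : ∀ i, ∃ c : ℝ, 0 < c ∧ ∀ k, C k i = c * C k (p (colBlock i)) := by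
    intro i
    have hzero : minor2 C i (p (colBlock i)) = 0 := by
      rcases eq_or_ne i (p (colBlock i)) with h | h
      · rw [← h, minor2, sub_self]
      · have := (hC (p (colBlock i)) i (hp₁ i h)).1 (hp₂ i)
        unfold minor2 at *
        linarith
    by_cases hi : i < 6
    · obtain ⟨h₁, h₂⟩ := hp₃ i hi
      exact ⟨_, col i _ 8 hzero (mul_pos ((hC i 8 h₁.1).2 h₁.2) ((hC _ 8 h₂.1).2 h₂.2))⟩
    · obtain ⟨h₁, h₂⟩ := hp₄ i hi
      refine ⟨_, col i _ 0 hzero ?_⟩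
      have := mul_pos ((hC 0 i h₁.1).2 h₁.2) ((hC 0 _ h₂.1).2 h₂.2)
      unfold minor2 at *
      linarith
  choose a ha hac using key
  refine ⟨a, fun r k => C k (p r), ha, fun k i => hac i k, fun r s hrs => ?_⟩
  exact (hC (p r) (p s) (hp₅ r s hrs).1).2 (hp₅ r s hrs).2

end SpurionCell

namespace PosMat

variable {Z : Matrix (Fin 9) (Fin 6) ℝ} {x : Fin 9 → ℝ}

/-- A vector in the left kernel of a totally positive matrix with proportional signs on one block
vanishes or alternates in sign along the collapse of that block. -/
lemma alternates (hZ : PosMat Z) (hx : Matrix.vecMul x Z = 0) (hx₀ : x ≠ 0) {r : Fin 3} {t : ℝ}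
    {c : Fin 9 → ℝ} (hc : ∀ i, 0 < c i) (hxt : ∀ i, colBlock i = r → x i = t * c i)
    {i j : Fin 9} (hij : (j : ℕ) = i + 1) (hr : colBlock i ≠ r ∨ colBlock j ≠ r) :
    x i * x j < 0 := by
  let g : Fin 3 → Fin 9 → Fin 7 :=
    ![![0, 0, 0, 1, 2, 3, 4, 5, 6], ![0, 1, 2, 3, 3, 3, 4, 5, 6], ![0, 1, 2, 3, 4, 5, 6, 6, 6]]
  have hg : ∀ r, Monotone (g r) := by decide
  have hg' : ∀ r, Function.Surjective (g r) := by decide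
  have hginj : ∀ r i j, g r i = g r j → i = j ∨ (colBlock i = r ∧ colBlock j = r) := by decide
  have hgadj : ∀ (r : Fin 3) (i j : Fin 9), (j : ℕ) = i + 1 →
      colBlock i ≠ r ∨ colBlock j ≠ r →
      ∃ k : Fin 6, g r i = k.castSucc ∧ g r j = k.succ := by decide
  obtain ⟨k, hki, hkj⟩ := hgadj r i j hij hr
  let d : Fin 9 → ℝ := fun i => if colBlock i = r then c i else 1
  have hd : ∀ i, 0 < d i := fun i => by
    simp only [d]
    split_ifs
    exacts [hc i, one_pos]
  let s : Fin 7 → ℝ := fun m => x (Function.surjInv (hg' r) m) / d (Function.surjInv (hg' r) m)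
  have hs : ∀ i, x i = s (g r i) * d i := by
    intro i
    have hi := Function.surjInv_eq (hg' r) (g r i)
    rcases hginj _ _ _ hi with h | ⟨h₁, h₂⟩
    · simp only [s, h]
      field_simp [(hd i).ne']
    · have := (hc (Function.surjInv (hg' r) (g r i))).ne'
      simp only [s, d, if_pos h₁, if_pos h₂, hxt _ h₁, hxt _ h₂]
      field_simp
  by_contra! h
  refine hx₀ (hZ.eq_zero_of_adjacent_mul_nonneg hx (hg r) (hg' r) hd hs k ?_)
  rw [hs i, hs j, mul_mul_mul_comm, hki, hkj] at h
  exact nonneg_of_mul_nonneg_left h (mul_pos (hd i) (hd j))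

/-- A vector in the left kernel of a totally positive matrix vanishes if it has constant sign on
two of the three blocks. -/
lemma eq_zero_of_two_blocks (hZ : PosMat Z) (hx : Matrix.vecMul x Z = 0) {r : Fin 3}
    {t : Fin 3 → ℝ} {c : Fin 9 → ℝ} (hc : ∀ i, 0 < c i)
    (hxt : ∀ i, colBlock i ≠ r → x i = t (colBlock i) * c i) : x = 0 := by
  have hsel : ∀ r, ∃ s, s ≠ r ∧ ∃ i j : Fin 9, (j : ℕ) = i + 1 ∧ colBlock i = colBlock j ∧
      colBlock i ≠ r ∧ colBlock i ≠ s := by decide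
  obtain ⟨s, hsr, i, j, hij, hb, hir, his⟩ := hsel r
  by_contra hx₀
  have hneg := hZ.alternates hx hx₀ hc (t := t s) (r := s)
    (fun i hi => by rw [hxt i (hi ▸ hsr), hi]) hij (Or.inl his)
  rw [hxt i hir, hxt j (hb ▸ hir), ← hb, mul_mul_mul_comm] at hneg
  exact hneg.not_ge (mul_nonneg (mul_self_nonneg _) (mul_pos (hc i) (hc j)).le)

/-- Three linearly dependent vectors in the left kernel of a totally positive matrix, the `r`-th of
constant sign on the `r`-th block, cannot all be nonzero. -/
lemma exists_eq_zero_of_dependent (hZ : PosMat Z) {y : Fin 3 → Fin 9 → ℝ}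
    (hy : ∀ r, Matrix.vecMul (y r) Z = 0) {t : Fin 3 → ℝ} {c : Fin 9 → ℝ} (hc : ∀ i, 0 < c i)
    (hyt : ∀ i, y (colBlock i) i = t (colBlock i) * c i) {α β γ : ℝ} (hα : 0 < α) (hβ : 0 < β)
    (hγ : 0 < γ) (hdep : ∀ i, β * y 1 i = α * y 0 i + γ * y 2 i) : ∃ r, y r = 0 := by
  by_contra! h
  have alt : ∀ r (i j : Fin 9), (j : ℕ) = i + 1 ∧ (colBlock i ≠ r ∨ colBlock j ≠ r) →
      y r i * y r j < 0 := fun r i j hij =>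
    hZ.alternates (hy r) (h r) hc (t := t r) (fun i hi => by rw [← hi, hyt]) hij.1 hij.2
  have ht : ∀ r, t r ≠ 0 := by
    have hedge : ∀ r : Fin 3, ∃ i j : Fin 9, (j : ℕ) = i + 1 ∧
        (colBlock i = r ∧ colBlock j ≠ r ∨ colBlock i ≠ r ∧ colBlock j = r) := by decide
    intro r h0
    obtain ⟨i, j, hij, ⟨hi, hj⟩ | ⟨hi, hj⟩⟩ := hedge r
    · have := alt r i j ⟨hij, Or.inr hj⟩
      rw [← hi, hyt, hi, h0, zero_mul, zero_mul] at this
      exact this.false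
    · have := alt r i j ⟨hij, Or.inl hi⟩
      rw [← hj, hyt j, hj, h0, zero_mul, mul_zero] at this
      exact this.false
  have same : ∀ r i j, colBlock i = r ∧ colBlock j = r → 0 < y r i * y r j := by
    rintro r i j ⟨rfl, hj⟩
    have hyj := hyt j
    rw [hj] at hyj
    rw [hyt i, hyj, mul_mul_mul_comm]
    exact mul_pos (mul_self_pos.2 (ht _)) (mul_pos (hc i) (hc j))
  have pos : ∀ i, 0 < y 0 i → 0 < y 2 i → 0 < y 1 i := fun i h₀ h₂ => by
    have := hdep i
    exact pos_of_mul_pos_right (a := β) (by rw [this]; positivity) hβ.le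
  have neg : ∀ i, y 0 i < 0 → y 2 i < 0 → y 1 i < 0 := fun i h₀ h₂ => by
    have := hdep i
    nlinarith [mul_neg_of_pos_of_neg hα h₀, mul_neg_of_pos_of_neg hγ h₂]
  have pp : ∀ {p q r : ℝ}, 0 < p * q → 0 < q * r → 0 < p * r := by
    simp only [mul_pos_iff]; grind
  have pn : ∀ {p q r : ℝ}, 0 < p * q → q * r < 0 → p * r < 0 := by
    simp only [mul_pos_iff, mul_neg_iff]; grind
  have nn : ∀ {p q r : ℝ}, p * q < 0 → q * r < 0 → 0 < p * r := by
    simp only [mul_pos_iff, mul_neg_iff]; grind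
  have e₀₁ := same 0 0 1 (by decide)
  have e₀₄ := pp (same 0 0 2 (by decide)) (nn (alt 0 2 3 (by decide)) (alt 0 3 4 (by decide)))
  have e₀₇ := pn (pp e₀₄ (nn (alt 0 4 5 (by decide)) (alt 0 5 6 (by decide))))
    (alt 0 6 7 (by decide))
  have e₁₁ := alt 1 0 1 (by decide)
  have e₁₃ := pn (nn e₁₁ (alt 1 1 2 (by decide))) (alt 1 2 3 (by decide))
  have e₁₄ := (mul_comm _ _).trans_lt (pn (same 1 4 3 (by decide)) ((mul_comm _ _).trans_lt e₁₃))
  have e₁₅ := (mul_comm _ _).trans_lt (pn (same 1 5 3 (by decide)) ((mul_comm _ _).trans_lt e₁₃))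
  have e₁₇ := pn (nn e₁₅ (alt 1 5 6 (by decide))) (alt 1 6 7 (by decide))
  have e₂₁ := alt 2 0 1 (by decide)
  have e₂₄ := nn (pn (nn e₂₁ (alt 2 1 2 (by decide))) (alt 2 2 3 (by decide)))
    (alt 2 3 4 (by decide))
  have e₂₇ := pp (nn (pn e₂₄ (alt 2 4 5 (by decide))) (alt 2 5 6 (by decide)))
    (same 2 6 7 (by decide))
  simp only [mul_pos_iff, mul_neg_iff] at e₀₁ e₀₄ e₀₇ e₁₁ e₁₄ e₁₇ e₂₁ e₂₄ e₂₇
  have pos₀ := pos 0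
  have pos₁ := pos 1
  have pos₄ := pos 4
  have pos₇ := pos 7
  have neg₀ := neg 0
  have neg₁ := neg 1
  have neg₄ := neg 4
  have neg₇ := neg 7
  clear e₁₃ e₁₅ pp pn nn pos neg alt same ht hdep hyt hc h hy hα hβ hγ
  grind

end PosMat

/-- A pair of vectors in the left kernel of a totally positive matrix vanishes if it is the
difference of two families of columns, each made of positive multiples of one vector per block,
and the vectors of the first family are positively oriented. -/
lemma PosMat.eq_zero_of_block_sub {Z : Matrix (Fin 9) (Fin 6) ℝ} (hZ : PosMat Z)
    {u : Fin 2 → Fin 9 → ℝ} (hu : ∀ k, Matrix.vecMul (u k) Z = 0) {a b : Fin 9 → ℝ}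
    (hb : ∀ i, 0 < b i) {v w : Fin 3 → Fin 2 → ℝ}
    (huv : ∀ k i, u k i = a i * v (colBlock i) k - b i * w (colBlock i) k)
    (hv : ∀ r s, r < s → 0 < v r 0 * v s 1 - v s 0 * v r 1) (k : Fin 2) : u k = 0 := by
  let y : Fin 3 → Fin 9 → ℝ := fun r => v r 1 • u 0 - v r 0 • u 1
  have hy : ∀ r, Matrix.vecMul (y r) Z = 0 := fun r => by
    simp only [y, Matrix.sub_vecMul, Matrix.smul_vecMul, hu, smul_zero, sub_zero]
  obtain ⟨r, hr⟩ := hZ.exists_eq_zero_of_dependent hy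
    (t := fun r => v r 0 * w r 1 - v r 1 * w r 0) hb
    (fun i => by simp [y, huv]; ring) (hv 1 2 (by decide)) (hv 0 2 (by decide))
    (hv 0 1 (by decide)) (fun i => by simp [y]; ring)
  have hne : ∀ s, s ≠ r → v r 1 * v s 0 - v r 0 * v s 1 ≠ 0 := by
    intro s hs
    rcases lt_or_gt_of_ne hs with h | h
    · exact (by linarith [hv s r h] : (0 : ℝ) < _).ne'
    · exact (by linarith [hv r s h] : _ < (0 : ℝ)).ne
  refine hZ.eq_zero_of_two_blocks (hu k) (r := r) hb (t := fun s =>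
    (v r 1 * w s 0 - v r 0 * w s 1) / (v r 1 * v s 0 - v r 0 * v s 1) * v s k - w s k)
    fun i hi => ?_
  have h := congrFun hr i
  simp only [y, Pi.sub_apply, Pi.smul_apply, smul_eq_mul, huv, Pi.zero_apply] at h
  have := hne _ hi
  rw [huv]
  field_simp
  linear_combination v (colBlock i) k * h

lemma rowSpan_le_of_rowSpan_mul_le {Z : Matrix (Fin 9) (Fin 6) ℝ} (hZ : PosMat Z)
    {C C' : Matrix (Fin 2) (Fin 9) ℝ} (hC : SpurionCell C) (hC' : SpurionCell C')
    (h : rowSpan (C * Z) ≤ rowSpan (C' * Z)) : rowSpan C ≤ rowSpan C' := by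
  have hG : ∀ k, ∃ g : Fin 2 → ℝ, ∑ m, g m • (C' * Z) m = (C * Z) k := fun k =>
    (Submodule.mem_span_range_iff_exists_fun ℝ).1 (h (Submodule.subset_span ⟨k, rfl⟩))
  choose G hG using hG
  obtain ⟨a, v, -, hav, hv⟩ := hC.exists_factor
  obtain ⟨b, w, hb, hbw, -⟩ := hC'.exists_factor
  have hzero : ∀ k, C k - ∑ m, G k m • C' m = 0 := by
    refine hZ.eq_zero_of_block_sub (a := a) (u := fun k => C k - ∑ m, G k m • C' m) (fun k => ?_) hb
      (w := fun r k => ∑ m, G k m * w r m) (fun k i => ?_) hv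
    · have hrow : ∀ (D : Matrix (Fin 2) (Fin 9) ℝ) m, Matrix.vecMul (D m) Z = (D * Z) m :=
        fun D m => (Matrix.mul_apply_eq_vecMul D Z m).symm
      rw [Matrix.sub_vecMul, Matrix.sum_vecMul, hrow, ← hG]
      simp [Matrix.smul_vecMul, hrow]
    · simp [hav, hbw]
      ring
  refine Submodule.span_le.2 ?_
  rintro _ ⟨k, rfl⟩
  change C k ∈ rowSpan C'
  rw [sub_eq_zero.1 (hzero k)]
  exact Submodule.sum_mem _ fun m _ => Submodule.smul_mem _ _ (Submodule.subset_span ⟨m, rfl⟩)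

/-- The amplituhedron map is injective on the spurion cell: if `C * Z` and
`C' * Z` have the same row span, then so do `C` and `C'`. -/
theorem spurion_amplituhedron_map_injective (Z : Matrix (Fin 9) (Fin 6) ℝ)
    (hZ : PosMat Z) (C C' : Matrix (Fin 2) (Fin 9) ℝ)
    (hC : SpurionCell C) (hC' : SpurionCell C')
    (h : rowSpan (C * Z) = rowSpan (C' * Z)) :
    rowSpan C = rowSpan C' := by
  exact le_antisymm (rowSpan_le_of_rowSpan_mul_le hZ hC hC' h.le)
    (rowSpan_le_of_rowSpan_mul_le hZ hC' hC h.ge)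
end

section
/- Definite signs of the spurion facet functionaries: let Z ∈ Mat^{>0}_{9,6} with rows Z_1,…,Z_9, let C be in the spurion cell S_sp ⊆ Mat_{2,9}(ℝ), and for an ordered tuple (i_1,i_2,i_3,i_4) write ⟪i_1 i_2 i_3 i_4⟫ for the determinant of the 6×6 matrix whose first two rows are the rows of CZ and whose last four rows are Z_{i_1}, Z_{i_2}, Z_{i_3}, Z_{i_4} in that order. Define a_1 = ⟪1236⟫⟪5789⟫ − ⟪1235⟫⟪6789⟫, a_2 = ⟪1236⟫⟪4789⟫ − ⟪1234⟫⟪6789⟫, a_3 = ⟪1235⟫⟪4789⟫ − ⟪1234⟫⟪5789⟫, a_4 = ⟪7892⟫⟪3456⟫ − ⟪7893⟫⟪2456⟫, a_5 = ⟪7891⟫⟪3456⟫ − ⟪7893⟫⟪1456⟫, a_6 = ⟪7891⟫⟪2456⟫ − ⟪7892⟫⟪1456⟫, a_7 = ⟪4568⟫⟪9123⟫ − ⟪4569⟫⟪8123⟫, a_8 = ⟪4567⟫⟪9123⟫ − ⟪4569⟫⟪7123⟫, a_9 = ⟪4567⟫⟪8123⟫ − ⟪4568⟫⟪7123⟫.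 Then a_2 > 0, a_5 > 0, a_8 > 0, and a_1, a_3, a_4, a_6, a_7, a_9 are all strictly negative. -/
open Finset

/-- The twistor coordinate `⟪i₁ i₂ i₃ i₄⟫` of the ordered tuple `(i₁, i₂, i₃, i₄)`:
the determinant of the `6 × 6` matrix whose first two rows are the rows of `C * Z`
and whose last four rows are `Z_{i₁}, Z_{i₂}, Z_{i₃}, Z_{i₄}` in that order. -/
noncomputable def tw (C : Matrix (Fin 2) (Fin 9) ℝ) (Z : Matrix (Fin 9) (Fin 6) ℝ)
    (i₁ i₂ i₃ i₄ : Fin 9) : ℝ :=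
  (Matrix.of ![(C * Z) 0, (C * Z) 1, Z i₁, Z i₂, Z i₃, Z i₄]).det

/-- The determinant of the `6 × 6` matrix with the given rows. -/
noncomputable def det6 (a b c d e f : Fin 6 → ℝ) : ℝ :=
  (Matrix.of ![a, b, c, d, e, f]).det

section Det6

variable (a b c d e f v : Fin 6 → ℝ) (r : ℝ)

theorem det6_eq : det6 a b c d e f = (Matrix.of ![a, b, c, d, e, f]).det := rfl

theorem det6_add0 : det6 (a + v) b c d e f = det6 a b c d e f + det6 v b c d e f := by
  convert Matrix.det_updateRow_add (Matrix.of ![a, b, c, d, e, f]) 0 a v using 2 <;>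
    (try unfold det6) <;> congr 1 <;> ext i j <;> fin_cases i <;> rfl

theorem det6_add1 : det6 a (b + v) c d e f = det6 a b c d e f + det6 a v c d e f := by
  convert Matrix.det_updateRow_add (Matrix.of ![a, b, c, d, e, f]) 1 b v using 2 <;>
    (try unfold det6) <;> congr 1 <;> ext i j <;> fin_cases i <;> rfl

theorem det6_add2 : det6 a b (c + v) d e f = det6 a b c d e f + det6 a b v d e f := by
  convert Matrix.det_updateRow_add (Matrix.of ![a, b, c, d, e, f]) 2 c v using 2 <;>
    (try unfold det6) <;> congr 1 <;> ext i j <;> fin_cases i <;> rfl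

theorem det6_add3 : det6 a b c (d + v) e f = det6 a b c d e f + det6 a b c v e f := by
  convert Matrix.det_updateRow_add (Matrix.of ![a, b, c, d, e, f]) 3 d v using 2 <;>
    (try unfold det6) <;> congr 1 <;> ext i j <;> fin_cases i <;> rfl

theorem det6_add4 : det6 a b c d (e + v) f = det6 a b c d e f + det6 a b c d v f := by
  convert Matrix.det_updateRow_add (Matrix.of ![a, b, c, d, e, f]) 4 e v using 2 <;>
    (try unfold det6) <;> congr 1 <;> ext i j <;> fin_cases i <;> rfl

theorem det6_add5 : det6 a b c d e (f + v) = det6 a b c d e f + det6 a b c d e v := by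
  convert Matrix.det_updateRow_add (Matrix.of ![a, b, c, d, e, f]) 5 f v using 2 <;>
    (try unfold det6) <;> congr 1 <;> ext i j <;> fin_cases i <;> rfl

theorem det6_smul0 : det6 (r • a) b c d e f = r * det6 a b c d e f := by
  convert Matrix.det_updateRow_smul (Matrix.of ![a, b, c, d, e, f]) 0 r a using 2 <;>
    (try unfold det6) <;> congr 1 <;> ext i j <;> fin_cases i <;> rfl

theorem det6_smul1 : det6 a (r • b) c d e f = r * det6 a b c d e f := by
  convert Matrix.det_updateRow_smul (Matrix.of ![a, b, c, d, e, f]) 1 r b using 2 <;>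
    (try unfold det6) <;> congr 1 <;> ext i j <;> fin_cases i <;> rfl

theorem det6_smul2 : det6 a b (r • c) d e f = r * det6 a b c d e f := by
  convert Matrix.det_updateRow_smul (Matrix.of ![a, b, c, d, e, f]) 2 r c using 2 <;>
    (try unfold det6) <;> congr 1 <;> ext i j <;> fin_cases i <;> rfl

theorem det6_smul3 : det6 a b c (r • d) e f = r * det6 a b c d e f := by
  convert Matrix.det_updateRow_smul (Matrix.of ![a, b, c, d, e, f]) 3 r d using 2 <;>
    (try unfold det6) <;> congr 1 <;> ext i j <;> fin_cases i <;> rfl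

theorem det6_smul4 : det6 a b c d (r • e) f = r * det6 a b c d e f := by
  convert Matrix.det_updateRow_smul (Matrix.of ![a, b, c, d, e, f]) 4 r e using 2 <;>
    (try unfold det6) <;> congr 1 <;> ext i j <;> fin_cases i <;> rfl

theorem det6_smul5 : det6 a b c d e (r • f) = r * det6 a b c d e f := by
  convert Matrix.det_updateRow_smul (Matrix.of ![a, b, c, d, e, f]) 5 r f using 2 <;>
    (try unfold det6) <;> congr 1 <;> ext i j <;> fin_cases i <;> rfl

@[simp] theorem det6_self01 : det6 a a c d e f = 0 :=
  Matrix.det_zero_of_row_eq (i := 0) (j := 1) (by decide) rfl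

@[simp] theorem det6_self02 : det6 a b a d e f = 0 :=
  Matrix.det_zero_of_row_eq (i := 0) (j := 2) (by decide) rfl

@[simp] theorem det6_self03 : det6 a b c a e f = 0 :=
  Matrix.det_zero_of_row_eq (i := 0) (j := 3) (by decide) rfl

@[simp] theorem det6_self04 : det6 a b c d a f = 0 :=
  Matrix.det_zero_of_row_eq (i := 0) (j := 4) (by decide) rfl

@[simp] theorem det6_self05 : det6 a b c d e a = 0 :=
  Matrix.det_zero_of_row_eq (i := 0) (j := 5) (by decide) rfl

@[simp] theorem det6_self12 : det6 a b b d e f = 0 :=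
  Matrix.det_zero_of_row_eq (i := 1) (j := 2) (by decide) rfl

@[simp] theorem det6_self13 : det6 a b c b e f = 0 :=
  Matrix.det_zero_of_row_eq (i := 1) (j := 3) (by decide) rfl

@[simp] theorem det6_self14 : det6 a b c d b f = 0 :=
  Matrix.det_zero_of_row_eq (i := 1) (j := 4) (by decide) rfl

@[simp] theorem det6_self15 : det6 a b c d e b = 0 :=
  Matrix.det_zero_of_row_eq (i := 1) (j := 5) (by decide) rfl

@[simp] theorem det6_self23 : det6 a b c c e f = 0 :=
  Matrix.det_zero_of_row_eq (i := 2) (j := 3) (by decide) rfl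

@[simp] theorem det6_self24 : det6 a b c d c f = 0 :=
  Matrix.det_zero_of_row_eq (i := 2) (j := 4) (by decide) rfl

@[simp] theorem det6_self25 : det6 a b c d e c = 0 :=
  Matrix.det_zero_of_row_eq (i := 2) (j := 5) (by decide) rfl

@[simp] theorem det6_self34 : det6 a b c d d f = 0 :=
  Matrix.det_zero_of_row_eq (i := 3) (j := 4) (by decide) rfl

@[simp] theorem det6_self35 : det6 a b c d e d = 0 :=
  Matrix.det_zero_of_row_eq (i := 3) (j := 5) (by decide) rfl

@[simp] theorem det6_self45 : det6 a b c d e e = 0 :=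
  Matrix.det_zero_of_row_eq (i := 4) (j := 5) (by decide) rfl

theorem det6_swap0 : det6 b a c d e f = -det6 a b c d e f := by
  have h := det6_self01 (a + b) c d e f
  rw [det6_add0, det6_add1, det6_add1, det6_self01, det6_self01] at h
  linarith

theorem det6_swap1 : det6 a c b d e f = -det6 a b c d e f := by
  have h := det6_self12 a (b + c) d e f
  rw [det6_add1, det6_add2, det6_add2, det6_self12, det6_self12] at h
  linarith

theorem det6_swap2 : det6 a b d c e f = -det6 a b c d e f := by
  have h := det6_self23 a b (c + d) e f
  rw [det6_add2, det6_add3, det6_add3, det6_self23, det6_self23] at h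
  linarith

theorem det6_swap3 : det6 a b c e d f = -det6 a b c d e f := by
  have h := det6_self34 a b c (d + e) f
  rw [det6_add3, det6_add4, det6_add4, det6_self34, det6_self34] at h
  linarith

theorem det6_swap4 : det6 a b c d f e = -det6 a b c d e f := by
  have h := det6_self45 a b c d (e + f)
  rw [det6_add4, det6_add5, det6_add5, det6_self45, det6_self45] at h
  linarith

end Det6

attribute [irreducible] det6

theorem exists_eq_of_det6_ne_zero {a b c d e f : Fin 6 → ℝ} (h : det6 a b c d e f ≠ 0)
    (v : Fin 6 → ℝ) : ∃ r : Fin 6 → ℝ,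
      v = r 0 • a + r 1 • b + r 2 • c + r 3 • d + r 4 • e + r 5 • f := by
  set M := Matrix.of ![a, b, c, d, e, f] with hM
  have hu : IsUnit M.det := isUnit_iff_ne_zero.mpr (by rwa [det6_eq] at h)
  refine ⟨Matrix.vecMul v M⁻¹, ?_⟩
  have hv : Matrix.vecMul (Matrix.vecMul v M⁻¹) M = v := by
    rw [Matrix.vecMul_vecMul, Matrix.nonsing_inv_mul _ hu, Matrix.vecMul_one]
  conv_lhs => rw [← hv]
  ext j
  rw [Matrix.vecMul, dotProduct, Fin.sum_univ_six]
  rfl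

/-- The three-term Plücker relation for four fixed rows. -/
theorem det6_plucker {a b c d u v : Fin 6 → ℝ} (h : det6 a b c d u v ≠ 0) (s t : Fin 6 → ℝ) :
    det6 a b c d u v * det6 a b c d s t =
      det6 a b c d u s * det6 a b c d v t - det6 a b c d u t * det6 a b c d v s := by
  obtain ⟨p, rfl⟩ := exists_eq_of_det6_ne_zero h s
  obtain ⟨q, rfl⟩ := exists_eq_of_det6_ne_zero h t
  simp only [det6_add4, det6_add5, det6_smul4, det6_smul5, det6_self04, det6_self05, det6_self14,
    det6_self15, det6_self24, det6_self25, det6_self34, det6_self35, det6_self45,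
    det6_swap4 a b c d u v]
  ring

/-- All ordered `6 × 6` minors of the nine vectors are positive. -/
def PosSeq (Z : Fin 9 → Fin 6 → ℝ) : Prop :=
  ∀ a b c d e f : Fin 9, a < b → b < c → c < d → d < e → e < f →
    0 < det6 (Z a) (Z b) (Z c) (Z d) (Z e) (Z f)

theorem PosMat.posSeq {Z : Matrix (Fin 9) (Fin 6) ℝ} (hZ : PosMat Z) :
    PosSeq Z := by
  intro a b c d e f hab hbc hcd hde hef
  have hm : StrictMono ![a, b, c, d, e, f] := by
    rw [Fin.strictMono_iff_lt_succ]
    intro i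
    fin_cases i <;> assumption
  have hcard : (univ.image ![a, b, c, d, e, f]).card = 6 := by
    rw [card_image_of_injective _ hm.injective]
    simp
  have h := hZ _ hcard
  rw [rowMinor, dif_pos hcard,
    ← orderEmbOfFin_unique hcard (fun i => mem_image_of_mem _ (mem_univ i)) hm] at h
  convert h using 1
  rw [det6_eq]
  congr 1
  ext i j
  fin_cases i <;> rfl

/-- The twisted cyclic rotation of nine vectors. -/
def rot (Z : Fin 9 → Fin 6 → ℝ) (i : Fin 9) : Fin 6 → ℝ :=
  if i = 8 then -Z 0 else Z (i + 1)

theorem PosSeq.rot {Z : Fin 9 → Fin 6 → ℝ} (hZ : PosSeq Z) : PosSeq (rot Z) := by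
  intro a b c d e f hab hbc hcd hde hef
  have ha : a ≠ 8 := by lia
  have hb : b ≠ 8 := by lia
  have hc : c ≠ 8 := by lia
  have hd : d ≠ 8 := by lia
  have he : e ≠ 8 := by lia
  by_cases hf : f = 8
  · have h := hZ 0 (a + 1) (b + 1) (c + 1) (d + 1) (e + 1)
      (by lia) (by lia) (by lia) (by lia) (by lia)
    simp only [_root_.rot, ha, hb, hc, hd, he, hf, if_true, if_false]
    rw [← neg_one_smul ℝ (Z 0), det6_smul5, det6_swap4, det6_swap3, det6_swap2, det6_swap1,
      det6_swap0]
    linarith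
  · simp only [_root_.rot, ha, hb, hc, hd, he, hf, if_false]
    exact hZ _ _ _ _ _ _ (by lia) (by lia) (by lia) (by lia) (by lia)

theorem rot_rot_rot_apply (Z : Fin 9 → Fin 6 → ℝ) (i : Fin 9) :
    rot (rot (rot Z)) i = ![Z 3, Z 4, Z 5, Z 6, Z 7, Z 8, -Z 0, -Z 1, -Z 2] i := by
  fin_cases i <;> rfl

/-- The combination of three consecutive vectors starting at `i`. -/
def blockSum (Z : Fin 9 → Fin 6 → ℝ) (l : Fin 9 → ℝ) (i : Fin 9) : Fin 6 → ℝ :=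
  l i • Z i + l (i + 1) • Z (i + 1) + l (i + 2) • Z (i + 2)

section Blocks

variable (x y w u v s : Fin 6 → ℝ)

theorem det6_split_three_two : det6 x u v y s w = -det6 x y w u v s := by
  rw [det6_swap2 x u y v s w, det6_swap1 x y u v s w, det6_swap4 x y u v w s,
    det6_swap3 x y u w v s, det6_swap2 x y w u v s]
  ring

theorem det6_split_four : det6 x u v s y w = det6 x y w u v s := by
  rw [det6_swap3 x u v y s w, det6_split_three_two, neg_neg]

theorem det6_split_two_three : det6 x u y v s w = det6 x y w u v s := by
  rw [det6_swap2 x u v y s w, det6_split_three_two, neg_neg]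

theorem det6_split_two : det6 x y u v s w = -det6 x y w u v s := by
  rw [det6_swap1 x u y v s w, det6_split_two_three]

theorem det6_rotate_three : det6 y w x u v s = det6 x y w u v s := by
  rw [det6_swap1 y x w, det6_swap0 x y w, neg_neg]

theorem det6_cycle : det6 x y w u v s = det6 x y w s u v := by
  rw [det6_swap4 x y w u s v, det6_swap3 x y w s u v, neg_neg]

end Blocks

section Core

variable {Z : Fin 9 → Fin 6 → ℝ} {l : Fin 9 → ℝ} {x y w : Fin 6 → ℝ}

theorem det6_block_pos (hZ : PosSeq Z) (hl : ∀ i, 0 < l i)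
    (hx : blockSum Z l 0 = x) (hy : blockSum Z l 3 = y) (hw : blockSum Z l 6 = w) :
    0 < det6 x (Z 2) (Z 3) y (Z 6) w ∧ 0 < det6 x (Z 2) (Z 3) y (Z 5) w ∧
    0 < det6 x (Z 1) (Z 2) y (Z 6) w ∧ 0 < det6 x (Z 1) (Z 2) (Z 3) y w ∧
    0 < det6 x (Z 3) y (Z 6) (Z 7) w ∧ 0 < det6 x (Z 2) y (Z 6) (Z 7) w ∧
    0 < det6 x (Z 3) y (Z 5) (Z 6) w := by
  subst hx hy hw
  refine ⟨?_, ?_, ?_, ?_, ?_, ?_, ?_⟩ <;>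
  · simp [blockSum, det6_add0, det6_add2, det6_add3, det6_add4, det6_add5, det6_smul0,
      det6_smul2, det6_smul3, det6_smul4, det6_smul5]
    repeat' (first | apply hl | apply add_pos | apply mul_pos | (apply hZ <;> decide))

theorem det6_block_lt (hZ : PosSeq Z) (hl : ∀ i, 0 < l i)
    (hx : blockSum Z l 0 = x) (hy : blockSum Z l 3 = y) (hw : blockSum Z l 6 = w) :
    det6 x y w (Z 1) (Z 2) (Z 5) * det6 x y w (Z 3) (Z 6) (Z 7) <
      det6 x y w (Z 1) (Z 2) (Z 3) * det6 x y w (Z 5) (Z 6) (Z 7) := by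
  obtain ⟨h236, h235, h126, h123, h367, h267, h356⟩ := det6_block_pos hZ hl hx hy hw
  rw [det6_split_three_two] at h236 h235 h126
  rw [det6_split_four] at h123
  rw [det6_split_two_three] at h367 h267 h356
  have P := det6_plucker (by linarith : det6 x y w (Z 2) (Z 3) (Z 6) ≠ 0) (Z 1) (Z 5)
  have R := det6_plucker (a := x) (b := y) (c := w) (d := Z 6) (u := Z 3) (v := Z 7)
    (by rw [det6_swap3]; linarith) (Z 2) (Z 5)
  rw [det6_swap3 x y w (Z 1) (Z 2), det6_swap4 x y w (Z 2) (Z 1), det6_swap3 x y w (Z 1) (Z 2),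
    det6_swap4 x y w (Z 2) (Z 5), det6_swap4 x y w (Z 2) (Z 1), det6_swap3 x y w (Z 1) (Z 2)] at P
  rw [det6_swap3 x y w (Z 3) (Z 6), det6_swap3 x y w (Z 2) (Z 6), det6_swap4 x y w (Z 2) (Z 5),
    det6_cycle x y w (Z 6) (Z 3) (Z 2), det6_swap4 x y w (Z 2) (Z 3),
    det6_cycle x y w (Z 6) (Z 7) (Z 5), det6_cycle x y w (Z 6) (Z 3) (Z 5),
    det6_cycle x y w (Z 5) (Z 6) (Z 3), det6_cycle x y w (Z 6) (Z 7) (Z 2)] at R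
  have h₁ := mul_pos (mul_pos h235 h126) h367
  have h₂ := mul_pos (mul_pos h123 h267) h356
  refine lt_of_mul_lt_mul_left ?_ h236.le
  linear_combination h₁ + h₂ + det6 x y w (Z 3) (Z 6) (Z 7) * P +
    det6 x y w (Z 1) (Z 2) (Z 3) * R

end Core

/-- The determinant with the bivector `p x∧y + q x∧w + r y∧w` in its first two rows, where
`x`, `y`, `w` are the combinations of the three blocks. -/
noncomputable def blockTwistor (Z : Fin 9 → Fin 6 → ℝ) (l : Fin 9 → ℝ) (p q r : ℝ)
    (a b c d : Fin 6 → ℝ) : ℝ :=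
  p * det6 (blockSum Z l 0) (blockSum Z l 3) a b c d +
    q * det6 (blockSum Z l 0) (blockSum Z l 6) a b c d +
    r * det6 (blockSum Z l 3) (blockSum Z l 6) a b c d

section BlockTwistor

variable {Z : Fin 9 → Fin 6 → ℝ} {l : Fin 9 → ℝ} {p q r : ℝ}

theorem mul_blockTwistor_left (u : Fin 6 → ℝ) :
    l 0 * blockTwistor Z l p q r (Z 0) (Z 1) (Z 2) u =
      r * det6 (blockSum Z l 0) (blockSum Z l 3) (blockSum Z l 6) (Z 1) (Z 2) u := by
  rw [blockTwistor, ← det6_rotate_three _ _ (blockSum Z l 6)]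
  generalize blockSum Z l 3 = y
  generalize blockSum Z l 6 = w
  simp [blockSum, det6_add0, det6_add2, det6_smul0, det6_smul2]
  ring

theorem mul_blockTwistor_right (u : Fin 6 → ℝ) :
    l 8 * blockTwistor Z l p q r u (Z 6) (Z 7) (Z 8) =
      -(p * det6 (blockSum Z l 0) (blockSum Z l 3) (blockSum Z l 6) u (Z 6) (Z 7)) := by
  rw [blockTwistor, ← mul_neg, ← det6_split_two]
  generalize blockSum Z l 0 = x
  generalize blockSum Z l 3 = y
  simp [blockSum, det6_add1, det6_add5, det6_smul1, det6_smul5]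
  ring

theorem blockTwistor_signs (hZ : PosSeq Z) (hl : ∀ i, 0 < l i) (hp : 0 < p) (hr : 0 < r)
    {F G : Fin 9 → ℝ} (hF : ∀ i, blockTwistor Z l p q r (Z 0) (Z 1) (Z 2) (Z i) = F i)
    (hG : ∀ i, blockTwistor Z l p q r (Z i) (Z 6) (Z 7) (Z 8) = G i) :
    0 < F 5 * G 3 - F 3 * G 5 ∧ F 5 * G 4 - F 4 * G 5 < 0 ∧ F 4 * G 3 - F 3 * G 4 < 0 := by
  have hlt := det6_block_lt hZ hl rfl rfl rfl
  have hy := det6_self15 (blockSum Z l 0) (blockSum Z l 3) (blockSum Z l 6) (Z 1) (Z 2)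
  have hy' := det6_self13 (blockSum Z l 0) (blockSum Z l 3) (blockSum Z l 6) (Z 6) (Z 7)
  have hF' (i) := hF i ▸ mul_blockTwistor_left (Z := Z) (l := l) (p := p) (q := q) (r := r) (Z i)
  have hG' (i) := hG i ▸ mul_blockTwistor_right (Z := Z) (l := l) (p := p) (q := q) (r := r) (Z i)
  set T := det6 (blockSum Z l 0) (blockSum Z l 3) (blockSum Z l 6) with hT
  have hFy : l 3 * F 3 + l 4 * F 4 + l 5 * F 5 = 0 := by
    have e : l 3 * T (Z 1) (Z 2) (Z 3) + l 4 * T (Z 1) (Z 2) (Z 4) +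
        l 5 * T (Z 1) (Z 2) (Z 5) = 0 := by
      rw [← hy]
      simp only [hT, ← det6_smul5, ← det6_add5]
      rfl
    refine (mul_eq_zero.mp ?_).resolve_left (hl 0).ne'
    linear_combination l 3 * hF' 3 + l 4 * hF' 4 + l 5 * hF' 5 + r * e
  have hGy : l 3 * G 3 + l 4 * G 4 + l 5 * G 5 = 0 := by
    have e : l 3 * T (Z 3) (Z 6) (Z 7) + l 4 * T (Z 4) (Z 6) (Z 7) +
        l 5 * T (Z 5) (Z 6) (Z 7) = 0 := by
      rw [← hy']
      simp only [hT, ← det6_smul3, ← det6_add3]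
      rfl
    refine (mul_eq_zero.mp ?_).resolve_left (hl 8).ne'
    linear_combination l 3 * hG' 3 + l 4 * hG' 4 + l 5 * hG' 5 - p * e
  have key : 0 < F 5 * G 3 - F 3 * G 5 := by
    refine pos_of_mul_pos_right (a := l 0 * l 8) ?_ (mul_pos (hl 0) (hl 8)).le
    have e : l 0 * l 8 * (F 5 * G 3 - F 3 * G 5) = r * p *
        (T (Z 1) (Z 2) (Z 3) * T (Z 5) (Z 6) (Z 7) -
          T (Z 1) (Z 2) (Z 5) * T (Z 3) (Z 6) (Z 7)) := by
      linear_combination l 8 * G 3 * hF' 5 + r * T (Z 1) (Z 2) (Z 5) * hG' 3 -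
        l 8 * G 5 * hF' 3 - r * T (Z 1) (Z 2) (Z 3) * hG' 5
    rw [e]
    exact mul_pos (mul_pos hr hp) (sub_pos.mpr hlt)
  refine ⟨key, neg_of_mul_neg_right (a := l 4) ?_ (hl 4).le,
    neg_of_mul_neg_right (a := l 4) ?_ (hl 4).le⟩
  · linear_combination mul_pos (hl 3) key + F 5 * hGy - G 5 * hFy
  · linear_combination mul_pos (hl 5) key + G 3 * hFy - F 3 * hGy

theorem blockTwistor_rot :
    blockTwistor (rot (rot (rot Z))) (fun i => l (i + 3)) r p q = blockTwistor Z l p q r := by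
  have h0 : blockSum (rot (rot (rot Z))) (fun i => l (i + 3)) 0 = blockSum Z l 3 := rfl
  have h3 : blockSum (rot (rot (rot Z))) (fun i => l (i + 3)) 3 = blockSum Z l 6 := rfl
  have h6 : blockSum (rot (rot (rot Z))) (fun i => l (i + 3)) 6 = (-1 : ℝ) • blockSum Z l 0 := by
    change l 0 • -Z 0 + l 1 • -Z 1 + l 2 • -Z 2 =
      (-1 : ℝ) • (l 0 • Z 0 + l 1 • Z 1 + l 2 • Z 2)
    module
  ext a b c d
  simp only [blockTwistor, h0, h3, h6, det6_smul1, det6_swap0 (blockSum Z l 0)]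
  ring

theorem blockTwistor_neg_first (a b c d : Fin 6 → ℝ) :
    blockTwistor Z l p q r (-a) b c d = -blockTwistor Z l p q r a b c d := by
  simp only [blockTwistor, ← neg_one_smul ℝ a, det6_smul2]
  ring

theorem blockTwistor_neg_second (a b c d : Fin 6 → ℝ) :
    blockTwistor Z l p q r a (-b) c d = -blockTwistor Z l p q r a b c d := by
  simp only [blockTwistor, ← neg_one_smul ℝ b, det6_smul3]
  ring

theorem blockTwistor_neg_third (a b c d : Fin 6 → ℝ) :
    blockTwistor Z l p q r a b (-c) d = -blockTwistor Z l p q r a b c d := by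
  simp only [blockTwistor, ← neg_one_smul ℝ c, det6_smul4]
  ring

theorem blockTwistor_neg_fourth (a b c d : Fin 6 → ℝ) :
    blockTwistor Z l p q r a b c (-d) = -blockTwistor Z l p q r a b c d := by
  simp only [blockTwistor, ← neg_one_smul ℝ d, det6_smul5]
  ring

end BlockTwistor

theorem eq_mul_of_minor2_eq_zero {C : Matrix (Fin 2) (Fin 9) ℝ} {i j e : Fin 9}
    (hij : minor2 C i j = 0) (he : minor2 C i e ≠ 0) (k : Fin 2) :
    C k j = minor2 C j e / minor2 C i e * C k i := by
  rw [div_mul_eq_mul_div, eq_div_iff he]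
  unfold minor2 at *
  revert k
  rw [Fin.forall_fin_two]
  constructor
  · linear_combination (C 0 e) * hij
  · linear_combination (C 1 e) * hij

theorem minor2_swap (C : Matrix (Fin 2) (Fin 9) ℝ) (i j : Fin 9) :
    minor2 C i j = -minor2 C j i := by
  unfold minor2
  ring

/-- Each column in the spurion cell is a positive multiple of the first column of its block. -/
theorem SpurionCell.exists_scale {C : Matrix (Fin 2) (Fin 9) ℝ} (hC : SpurionCell C) :
    ∃ l : Fin 9 → ℝ, (∀ j, 0 < l j) ∧ ∀ j k, C k j = l j * C k (3 * (j / 3)) := by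
  have h (j : Fin 9) : ∃ c : ℝ, 0 < c ∧ ∀ k, C k j = c * C k (3 * (j / 3)) := by
    have hj : minor2 C (3 * (j / 3)) j = 0 := by
      have hd : ∀ j : Fin 9, 3 * (j / 3) = j ∨
          3 * (j / 3) < j ∧ ((3 * (j / 3) : Fin 9) : ℕ) / 3 = (j : ℕ) / 3 := by decide
      rcases hd j with hd | ⟨hlt, hd⟩
      · rw [hd, minor2, sub_self]
      · exact (hC _ _ hlt).1 hd
    by_cases h6 : j < 6
    · have hd : ∀ j : Fin 9, j < 6 → j < 8 ∧ (j : ℕ) / 3 ≠ ((8 : Fin 9) : ℕ) / 3 ∧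
          3 * (j / 3) < 8 ∧ ((3 * (j / 3) : Fin 9) : ℕ) / 3 ≠ ((8 : Fin 9) : ℕ) / 3 := by decide
      obtain ⟨h₁, h₂, h₃, h₄⟩ := hd j h6
      have hb := (hC _ _ h₃).2 h₄
      exact ⟨_, div_pos ((hC _ _ h₁).2 h₂) hb, eq_mul_of_minor2_eq_zero hj hb.ne'⟩
    · have hd : ∀ j : Fin 9, ¬ j < 6 → 0 < j ∧ ((0 : Fin 9) : ℕ) / 3 ≠ (j : ℕ) / 3 ∧
          0 < 3 * (j / 3) ∧ ((0 : Fin 9) : ℕ) / 3 ≠ ((3 * (j / 3) : Fin 9) : ℕ) / 3 := by decide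
      obtain ⟨h₁, h₂, h₃, h₄⟩ := hd j h6
      have ha := (hC _ _ h₁).2 h₂
      have hb := (hC _ _ h₃).2 h₄
      rw [minor2_swap, neg_pos] at ha hb
      exact ⟨_, div_pos_of_neg_of_neg ha hb, eq_mul_of_minor2_eq_zero hj hb.ne⟩
  choose l hl hC' using h
  exact ⟨l, hl, hC'⟩

theorem tw_eq_blockTwistor {C : Matrix (Fin 2) (Fin 9) ℝ} {l : Fin 9 → ℝ}
    (hl : ∀ j k, C k j = l j * C k (3 * (j / 3)))
    (Z : Matrix (Fin 9) (Fin 6) ℝ) (i₁ i₂ i₃ i₄ : Fin 9) :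
    tw C Z i₁ i₂ i₃ i₄ = blockTwistor Z l (minor2 C 0 3) (minor2 C 0 6)
      (minor2 C 3 6) (Z i₁) (Z i₂) (Z i₃) (Z i₄) := by
  have hrow (k : Fin 2) : (C * Z) k = C k 0 • blockSum Z l 0 +
      C k 3 • blockSum Z l 3 + C k 6 • blockSum Z l 6 := by
    ext t
    have h : (C * Z) k t = ∑ j, l j * C k (3 * (j / 3)) * Z j t := by
      rw [Matrix.mul_apply]
      exact sum_congr rfl fun j _ => by rw [← hl]
    have e : (C * Z) k t = l 0 * C k 0 * Z 0 t + l 1 * C k 0 * Z 1 t + l 2 * C k 0 * Z 2 t +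
        l 3 * C k 3 * Z 3 t + l 4 * C k 3 * Z 4 t + l 5 * C k 3 * Z 5 t +
        l 6 * C k 6 * Z 6 t + l 7 * C k 6 * Z 7 t + l 8 * C k 6 * Z 8 t := by
      rw [h]
      simp only [Fin.sum_univ_castSucc, Fin.sum_univ_zero, zero_add]
      rfl
    rw [e]
    change _ = C k 0 * (l 0 * Z 0 t + l 1 * Z 1 t + l 2 * Z 2 t) +
      C k 3 * (l 3 * Z 3 t + l 4 * Z 4 t + l 5 * Z 5 t) +
      C k 6 * (l 6 * Z 6 t + l 7 * Z 7 t + l 8 * Z 8 t)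
    ring
  rw [tw, hrow, hrow, ← det6_eq]
  unfold blockTwistor
  generalize blockSum Z l 0 = x
  generalize blockSum Z l 3 = y
  generalize blockSum Z l 6 = w
  simp only [det6_add0, det6_add1, det6_smul0, det6_smul1, det6_self01, det6_swap0 x y,
    det6_swap0 x w, det6_swap0 y w, minor2]
  ring

/-- Definite signs of the spurion facet functionaries: writing `1, …, 9` for the
`0`-based indices `0, …, 8`, the functionaries `a₂, a₅, a₈` are strictly positive on
the open spurion tile and `a₁, a₃, a₄, a₆, a₇, a₉` are strictly negative. -/
theorem spurion_functionary_signs (Z : Matrix (Fin 9) (Fin 6) ℝ) (hZ : PosMat Z)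
    (C : Matrix (Fin 2) (Fin 9) ℝ) (hC : SpurionCell C) :
    -- a₂ = ⟪1236⟫⟪4789⟫ − ⟪1234⟫⟪6789⟫ > 0
    (0 < tw C Z 0 1 2 5 * tw C Z 3 6 7 8 - tw C Z 0 1 2 3 * tw C Z 5 6 7 8) ∧
    -- a₅ = ⟪7891⟫⟪3456⟫ − ⟪7893⟫⟪1456⟫ > 0
    (0 < tw C Z 6 7 8 0 * tw C Z 2 3 4 5 - tw C Z 6 7 8 2 * tw C Z 0 3 4 5) ∧
    -- a₈ = ⟪4567⟫⟪9123⟫ − ⟪4569⟫⟪7123⟫ > 0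
    (0 < tw C Z 3 4 5 6 * tw C Z 8 0 1 2 - tw C Z 3 4 5 8 * tw C Z 6 0 1 2) ∧
    -- a₁ = ⟪1236⟫⟪5789⟫ − ⟪1235⟫⟪6789⟫ < 0
    (tw C Z 0 1 2 5 * tw C Z 4 6 7 8 - tw C Z 0 1 2 4 * tw C Z 5 6 7 8 < 0) ∧
    -- a₃ = ⟪1235⟫⟪4789⟫ − ⟪1234⟫⟪5789⟫ < 0
    (tw C Z 0 1 2 4 * tw C Z 3 6 7 8 - tw C Z 0 1 2 3 * tw C Z 4 6 7 8 < 0) ∧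
    -- a₄ = ⟪7892⟫⟪3456⟫ − ⟪7893⟫⟪2456⟫ < 0
    (tw C Z 6 7 8 1 * tw C Z 2 3 4 5 - tw C Z 6 7 8 2 * tw C Z 1 3 4 5 < 0) ∧
    -- a₆ = ⟪7891⟫⟪2456⟫ − ⟪7892⟫⟪1456⟫ < 0
    (tw C Z 6 7 8 0 * tw C Z 1 3 4 5 - tw C Z 6 7 8 1 * tw C Z 0 3 4 5 < 0) ∧
    -- a₇ = ⟪4568⟫⟪9123⟫ − ⟪4569⟫⟪8123⟫ < 0
    (tw C Z 3 4 5 7 * tw C Z 8 0 1 2 - tw C Z 3 4 5 8 * tw C Z 7 0 1 2 < 0) ∧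
    -- a₉ = ⟪4567⟫⟪8123⟫ − ⟪4568⟫⟪7123⟫ < 0
    (tw C Z 3 4 5 6 * tw C Z 7 0 1 2 - tw C Z 3 4 5 7 * tw C Z 6 0 1 2 < 0) := by
  obtain ⟨l, hl, hCl⟩ := hC.exists_scale
  have hp : 0 < minor2 C 0 3 := (hC 0 3 (by decide)).2 (by decide)
  have hq : 0 < minor2 C 0 6 := (hC 0 6 (by decide)).2 (by decide)
  have hr : 0 < minor2 C 3 6 := (hC 3 6 (by decide)).2 (by decide)
  have hZ₀ := hZ.posSeq
  have hZ₁ := hZ₀.rot.rot.rot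
  have hZ₂ := hZ₁.rot.rot.rot
  obtain ⟨h₂, h₁, h₃⟩ := blockTwistor_signs (q := minor2 C 0 6) hZ₀ hl hp hr
    (fun _ => rfl) (fun _ => rfl)
  obtain ⟨h₈, h₇, h₉⟩ := blockTwistor_signs (q := minor2 C 0 3) hZ₁ (fun i => hl (i + 3)) hr hq
    (fun _ => rfl) (fun _ => rfl)
  obtain ⟨h₅, h₄, h₆⟩ := blockTwistor_signs (q := minor2 C 3 6) hZ₂ (fun i => hl (i + 3 + 3)) hq hp
    (fun _ => rfl) (fun _ => rfl)
  have e := blockTwistor_rot (Z := Z) (l := l) (p := minor2 C 0 3) (q := minor2 C 0 6)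
    (r := minor2 C 3 6)
  have e' := blockTwistor_rot (Z := rot (rot (rot Z))) (l := fun i => l (i + 3))
    (p := minor2 C 3 6) (q := minor2 C 0 3) (r := minor2 C 0 6)
  rw [e] at h₇ h₈ h₉ e'
  rw [e'] at h₄ h₅ h₆
  simp only [rot_rot_rot_apply, rot_rot_rot_apply Z, Matrix.cons_val, neg_neg,
    blockTwistor_neg_first (Z := Z), blockTwistor_neg_second (Z := Z),
    blockTwistor_neg_third (Z := Z), blockTwistor_neg_fourth (Z := Z)] at h₄ h₅ h₆ h₇ h₈ h₉
  simp only [tw_eq_blockTwistor hCl]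
  refine ⟨h₂, ?_, ?_, h₁, h₃, ?_, ?_, ?_, ?_⟩ <;> linarith
end
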